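/- Let k be a non-Archimedean local field with normalized additive valuation ν (so ν(k^×) = ℤ), D a central division k-algebra of index 2 carrying the unique valuation (again denoted ν) extending ν on k, and E|k a finite field extension of odd degree carrying the valuation (again denoted ν) extending ν on k; write e := e(E|k) and f := f(E|k), and assume Δ := E ⊗_k D is a division ring. Fix uniformizers π_E of E and π_D of D. Then the map ν⊗ν : Δ → ℝ ∪ {∞} defined by (ν⊗ν)(t) := sup{ inf{ ν(e_i) + ν(d_i) : i ∈ I } : over all finite representations t = Σ_{i∈I} e_i ⊗ d_i with e_i ∈ E, d_i ∈ D } is the valuation on Δ extending ν on k, and moreover: (i) the element π_Δ := π_E^{(1−e)/2} ⊗ π_D is a prime element of Δ, with (ν⊗ν)(π_Δ) = 1/(2e); (ii) the valuation ring of Δ equals the additive subgroup (o_E ⊗_{o_k} o_D) + (𝔭_E^{(1−e)/2} ⊗_{o_k} 𝔭_D) of Δ, where 𝔭_E^{(1−e)/2} := π_E^{(1−e)/2}·o_E; (iii) the valuation ideal of Δ equals (𝔭_E ⊗_{o_k} o_D) + (𝔭_E^{(1−e)/2} ⊗_{o_k} 𝔭_D). -/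

import Mathlib

noncomputable section

/-- Axioms expressing that `ν : K → EReal` is the additive valuation of a
non-Archimedean local (skew) field structure on `K`, normalized relatively to a base
field with valuation group `ℤ`, so that the value group of `K` is `(1/e)ℤ`; `K` is
complete and its residue field has exactly `q` elements (encoded by a complete finite
set of residue representatives). -/
structure IsLocalValuation (K : Type*) [DivisionRing K] (ν : K → EReal) (e q : ℕ) : Prop where
  e_pos : 0 < e
  one_lt_q : 1 < q
  eq_top_iff : ∀ x : K, ν x = ⊤ ↔ x = 0
  map_mul : ∀ x y : K, ν (x * y) = ν x + ν y
  min_le_add : ∀ x y : K, min (ν x) (ν y) ≤ ν (x + y)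
  values : ∀ x : K, x ≠ 0 → ∃ m : ℤ, ν x = ((m / e : ℝ) : EReal)
  exists_uniformizer : ∃ π : K, ν π = (((e : ℝ)⁻¹ : ℝ) : EReal)
  complete : ∀ x : ℕ → K,
      (∀ M : ℝ, ∃ N : ℕ, ∀ m ≥ N, ∀ n ≥ N, (M : EReal) ≤ ν (x m - x n)) →
      ∃ l : K, ∀ M : ℝ, ∃ N : ℕ, ∀ n ≥ N, (M : EReal) ≤ ν (x n - l)
  residue : ∃ s : Finset K, s.card = q ∧ (∀ y ∈ s, 0 ≤ ν y) ∧
      ∀ x : K, 0 ≤ ν x → ∃! y, y ∈ s ∧ 0 < ν (x - y)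

open scoped TensorProduct

/-- The sup-inf extension `ν⊗ν` of a pair of (additive, `EReal`-valued) valuations to
the tensor product: `(ν⊗ν)(t) = sup { inf_i (νE(eᵢ) + νD(dᵢ)) : t = Σᵢ eᵢ ⊗ dᵢ }`. -/
noncomputable def tensorVal (k : Type*) {E D : Type*} [Field k] [Field E] [DivisionRing D]
    [Algebra k E] [Algebra k D] (νE : E → EReal) (νD : D → EReal)
    (t : TensorProduct k E D) : EReal :=
  sSup {r : EReal | ∃ (n : ℕ) (a : Fin n → E) (b : Fin n → D),
    t = ∑ i, a i ⊗ₜ[k] b i ∧ r = ⨅ i, (νE (a i) + νD (b i))}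

/-- A map to `EReal` satisfying the ultrametric inequality, invariant under negation and sending
`0` to `⊤`. -/
structure IsUltrametricMap {M : Type*} [AddCommGroup M] (w : M → EReal) : Prop where
  map_zero : w 0 = ⊤
  map_neg : ∀ x, w (-x) = w x
  min_le_add : ∀ x y, min (w x) (w y) ≤ w (x + y)

namespace IsUltrametricMap

variable {M : Type*} [AddCommGroup M] {w : M → EReal}

theorem le_add (hw : IsUltrametricMap w) {x y : M} {r : EReal} (hx : r ≤ w x) (hy : r ≤ w y) :
    r ≤ w (x + y) :=
  (le_min hx hy).trans (hw.min_le_add x y)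

theorem le_sub (hw : IsUltrametricMap w) {x y : M} {r : EReal} (hx : r ≤ w x) (hy : r ≤ w y) :
    r ≤ w (x - y) := by
  rw [sub_eq_add_neg]
  exact hw.le_add hx (by rwa [hw.map_neg])

theorem lt_add (hw : IsUltrametricMap w) {x y : M} {r : EReal} (hx : r < w x) (hy : r < w y) :
    r < w (x + y) :=
  (lt_min hx hy).trans_le (hw.min_le_add x y)

theorem lt_sub (hw : IsUltrametricMap w) {x y : M} {r : EReal} (hx : r < w x) (hy : r < w y) :
    r < w (x - y) := by
  rw [sub_eq_add_neg]
  exact hw.lt_add hx (by rwa [hw.map_neg])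

theorem le_sum (hw : IsUltrametricMap w) {ι : Type*} (s : Finset ι) {g : ι → M} {r : EReal}
    (h : ∀ i ∈ s, r ≤ w (g i)) : r ≤ w (∑ i ∈ s, g i) :=
  Finset.sum_induction g (fun x => r ≤ w x) (fun _ _ => hw.le_add) (by simp [hw.map_zero]) h

theorem map_add_of_lt (hw : IsUltrametricMap w) {x y : M} (h : w x < w y) :
    w (x + y) = w x := by
  refine le_antisymm ?_ (hw.le_add le_rfl h.le)
  by_contra! h'
  have := hw.lt_sub h' h
  simp at this

theorem map_add_le_left (hw : IsUltrametricMap w) {x y : M} (h : w x = w y → w x = ⊤) :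
    w (x + y) ≤ w x := by
  rcases lt_trichotomy (w x) (w y) with h' | h' | h'
  · exact (hw.map_add_of_lt h').le
  · simp [h h']
  · rw [add_comm, hw.map_add_of_lt h']
    exact h'.le

end IsUltrametricMap

namespace IsLocalValuation

variable {K : Type*} [DivisionRing K] {ν : K → EReal} {e q : ℕ}

theorem map_zero (h : IsLocalValuation K ν e q) : ν 0 = ⊤ := (h.eq_top_iff 0).2 rfl

theorem exists_real (h : IsLocalValuation K ν e q) {x : K} (hx : x ≠ 0) :
    ∃ r : ℝ, ν x = r := by
  obtain ⟨m, hm⟩ := h.values x hx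
  exact ⟨_, hm⟩

theorem ne_bot (h : IsLocalValuation K ν e q) (x : K) : ν x ≠ ⊥ := by
  by_cases hx : x = 0
  · simp [hx, h.map_zero]
  · obtain ⟨r, hr⟩ := h.exists_real hx
    simp [hr]

theorem map_one (h : IsLocalValuation K ν e q) : ν 1 = 0 := by
  obtain ⟨r, hr⟩ := h.exists_real (one_ne_zero (α := K))
  have := h.map_mul 1 1
  rw [mul_one, hr] at this
  norm_cast at this
  rw [hr]
  norm_cast
  linarith

theorem map_neg (h : IsLocalValuation K ν e q) (x : K) : ν (-x) = ν x := by
  obtain ⟨r, hr⟩ := h.exists_real (neg_ne_zero.2 (one_ne_zero (α := K)))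
  have := h.map_mul (-1) (-1)
  rw [neg_mul_neg, mul_one, hr, h.map_one] at this
  norm_cast at this
  rw [neg_eq_neg_one_mul, h.map_mul, hr, show r = 0 by linarith]
  simp

theorem isUltrametricMap (h : IsLocalValuation K ν e q) : IsUltrametricMap ν :=
  ⟨h.map_zero, h.map_neg, h.min_le_add⟩

theorem ne_zero_of_eq (h : IsLocalValuation K ν e q) {x : K} {r : ℝ} (hx : ν x = r) : x ≠ 0 := by
  rintro rfl
  simp [h.map_zero] at hx

theorem map_inv (h : IsLocalValuation K ν e q) {x : K} {r : ℝ} (hx : ν x = r) :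
    ν x⁻¹ = ((-r : ℝ) : EReal) := by
  have hx0 := h.ne_zero_of_eq hx
  obtain ⟨s, hs⟩ := h.exists_real (inv_ne_zero hx0)
  have := h.map_mul x x⁻¹
  rw [mul_inv_cancel₀ hx0, h.map_one, hx, hs] at this
  norm_cast at this
  rw [hs]
  norm_cast
  linarith

theorem map_pow (h : IsLocalValuation K ν e q) {x : K} {r : ℝ} (hx : ν x = r) (n : ℕ) :
    ν (x ^ n) = ((n * r : ℝ) : EReal) := by
  induction n with
  | zero => simp [h.map_one]
  | succ n ih =>
    rw [pow_succ, h.map_mul, ih, hx]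
    norm_cast
    push_cast
    ring

theorem map_zpow (h : IsLocalValuation K ν e q) {x : K} {r : ℝ} (hx : ν x = r) (n : ℤ) :
    ν (x ^ n) = ((n * r : ℝ) : EReal) := by
  cases n with
  | ofNat n => simpa using h.map_pow hx n
  | negSucc n =>
    rw [zpow_negSucc, h.map_inv (h.map_pow hx (n + 1))]
    norm_cast
    push_cast
    ring

theorem le_mul (h : IsLocalValuation K ν e q) {x y : K} (hx : 0 ≤ ν x) (hy : 0 ≤ ν y) :
    0 ≤ ν (x * y) := by
  rw [h.map_mul]
  exact add_nonneg hx hy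

end IsLocalValuation

namespace IsLocalValuation

variable {K : Type*} [Field K] {ν : K → EReal} {e q : ℕ}

/-- The valuation ring of an additive valuation on a field. -/
def valuationSubring (h : IsLocalValuation K ν e q) : ValuationSubring K where
  carrier := {x | 0 ≤ ν x}
  mul_mem' hx hy := h.le_mul hx hy
  one_mem' := h.map_one.ge
  add_mem' hx hy := h.isUltrametricMap.le_add hx hy
  zero_mem' := by simp [h.map_zero]
  neg_mem' {x} hx := by simpa [h.map_neg] using hx
  mem_or_inv_mem' x := by
    by_cases hx : x = 0
    · simp [hx, h.map_zero]
    · obtain ⟨r, hr⟩ := h.exists_real hx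
      simp only [Set.mem_ofPred_eq, h.map_inv hr, hr]
      norm_cast
      rcases le_total 0 r with h0 | h0
      · exact Or.inl h0
      · exact Or.inr (by linarith)

theorem mem_valuationSubring (h : IsLocalValuation K ν e q) {x : K} :
    x ∈ h.valuationSubring ↔ 0 ≤ ν x := Iff.rfl

theorem isUnit_valuationSubring (h : IsLocalValuation K ν e q) (x : h.valuationSubring) :
    IsUnit x ↔ ν (x : K) = 0 := by
  constructor
  · rintro ⟨u, rfl⟩
    have h1 : 0 ≤ ν ((u : h.valuationSubring) : K) := (u : h.valuationSubring).2
    have h2 : 0 ≤ ν ((u⁻¹.val : h.valuationSubring) : K) := (u⁻¹.val : h.valuationSubring).2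
    have h3 : ν ((u : h.valuationSubring) : K) + ν ((u⁻¹.val : h.valuationSubring) : K) = 0 := by
      rw [← h.map_mul, ← h.map_one]
      congr 1
      exact_mod_cast congrArg Subtype.val u.mul_inv
    exact le_antisymm (h3 ▸ le_add_of_nonneg_right h2) h1
  · intro hx
    have hinv := h.map_inv (x := (x : K)) (r := 0) (by simpa using hx)
    have hx0 := h.ne_zero_of_eq (x := (x : K)) (r := 0) (by simpa using hx)
    refine IsUnit.of_mul_eq_one ⟨(x : K)⁻¹, by simp [h.mem_valuationSubring, hinv]⟩ ?_
    ext
    simp [hx0]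

theorem residue_eq_zero_iff (h : IsLocalValuation K ν e q) (x : h.valuationSubring) :
    IsLocalRing.residue h.valuationSubring x = 0 ↔ 0 < ν (x : K) := by
  rw [IsLocalRing.residue_eq_zero_iff, IsLocalRing.mem_maximalIdeal, mem_nonunits_iff,
    h.isUnit_valuationSubring, lt_iff_le_and_ne, ne_comm]
  exact ⟨fun h' => ⟨x.2, h'⟩, fun h' => h'.2⟩

theorem card_residueField (h : IsLocalValuation K ν e q) :
    Nat.card (IsLocalRing.ResidueField h.valuationSubring) = q := by
  obtain ⟨s, hs, hs0, hs1⟩ := h.residue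
  have key : Nat.card s = Nat.card (IsLocalRing.ResidueField h.valuationSubring) := by
    refine Nat.card_eq_of_bijective
      (fun y : s => IsLocalRing.residue h.valuationSubring ⟨y, hs0 y y.2⟩) ⟨?_, ?_⟩
    · intro y z hyz
      have hyz : IsLocalRing.residue h.valuationSubring ⟨y, hs0 y y.2⟩ =
        IsLocalRing.residue h.valuationSubring ⟨z, hs0 z z.2⟩ := hyz
      rw [← sub_eq_zero, ← map_sub, h.residue_eq_zero_iff] at hyz
      refine Subtype.ext ((hs1 y (hs0 y y.2)).unique ⟨y.2, ?_⟩ ⟨z.2, hyz⟩)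
      simp [h.map_zero]
    · intro x
      obtain ⟨x, rfl⟩ := IsLocalRing.residue_surjective x
      obtain ⟨y, ⟨hy, hxy⟩, -⟩ := hs1 x x.2
      refine ⟨⟨y, hy⟩, Eq.symm ?_⟩
      rw [← sub_eq_zero, ← map_sub, h.residue_eq_zero_iff]
      exact hxy
  rw [← key, ← hs]
  simp

end IsLocalValuation

theorem FiniteField.not_root_quadratic_of_odd {F L : Type*} [Field F] [Field L] (φ : F →+* L)
    [Finite F] [Finite L] {f : ℕ} (hf : Odd f) (hcard : Nat.card L = Nat.card F ^ f) (a b : F)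
    (hroot : ∀ c : F, c ^ 2 - a * c - b ≠ 0) (x : L) : x ^ 2 - φ a * x - φ b ≠ 0 := by
  algebraize [φ]
  intro hx
  have hfin : Module.finrank F L = f := by
    have := Module.natCard_eq_pow_finrank (K := F) (V := L)
    rw [hcard] at this
    exact (Nat.pow_right_injective (Finite.one_lt_card (α := F)) this).symm
  set p : Polynomial F := .X ^ 2 - .C a * .X - .C b with hp
  have hpm : p.Monic := by rw [hp]; monicity!
  have hpd : p.natDegree = 2 := by rw [hp]; compute_degree!
  have hirr : Irreducible p := by
    rw [hpm.irreducible_iff_roots_eq_zero_of_degree_le_three hpd.ge (by omega)]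
    refine Multiset.eq_zero_of_forall_notMem fun c hc => hroot c ?_
    simpa [hp] using (Polynomial.mem_roots'.1 hc).2
  have hmin : p = minpoly F x := by
    refine minpoly.eq_of_irreducible_of_monic hirr ?_ hpm
    simpa [hp, RingHom.algebraMap_toAlgebra] using hx
  have h2 := minpoly.degree_dvd (K := F) (x := x) (Algebra.IsIntegral.isIntegral x)
  rw [← hmin, hpd, hfin] at h2
  exact (Nat.not_even_iff_odd.2 hf) (even_iff_two_dvd.2 h2)

theorem IsLocalValuation.not_root_quadratic_of_odd {k E : Type*} [Field k] [Field E] [Algebra k E]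
    {νk : k → EReal} {νE : E → EReal} {e₁ e₂ q f : ℕ}
    (hk : IsLocalValuation k νk e₁ q) (hE : IsLocalValuation E νE e₂ (q ^ f))
    (hcompat : ∀ c : k, νE (algebraMap k E c) = νk c) (hf : Odd f) {a b : k}
    (ha : 0 ≤ νk a) (hb : 0 ≤ νk b) (hroot : ∀ c : k, ¬ 0 < νk (c ^ 2 - a * c - b))
    {x : E} (hx : 0 ≤ νE x) :
    ¬ 0 < νE (x ^ 2 - algebraMap k E a * x - algebraMap k E b) := by
  let A := hk.valuationSubring
  let B := hE.valuationSubring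
  let ψ : A →+* B := ((algebraMap k E).comp A.subtype).codRestrict B.toSubring fun c => by
    change 0 ≤ νE (algebraMap k E c)
    rw [hcompat]
    exact c.2
  have hψ (c : A) : ((ψ c : B) : E) = algebraMap k E c := rfl
  have : IsLocalHom ψ := ⟨fun c hc => by
    rw [hE.isUnit_valuationSubring, hψ, hcompat] at hc
    rwa [hk.isUnit_valuationSubring]⟩
  have hcA : Nat.card (IsLocalRing.ResidueField A) = q := hk.card_residueField
  have hcB : Nat.card (IsLocalRing.ResidueField B) = q ^ f := hE.card_residueField
  have : Finite (IsLocalRing.ResidueField A) :=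
    Nat.finite_of_card_ne_zero (by rw [hcA]; exact (zero_lt_one.trans hk.one_lt_q).ne')
  have : Finite (IsLocalRing.ResidueField B) :=
    Nat.finite_of_card_ne_zero (by rw [hcB]; exact (zero_lt_one.trans hE.one_lt_q).ne')
  have key := FiniteField.not_root_quadratic_of_odd (IsLocalRing.ResidueField.map ψ) hf
    (by rw [hcA, hcB]) (IsLocalRing.residue A ⟨a, ha⟩) (IsLocalRing.residue A ⟨b, hb⟩) ?_
    (IsLocalRing.residue B ⟨x, hx⟩)
  · intro h
    apply key
    rw [IsLocalRing.ResidueField.map_residue, IsLocalRing.ResidueField.map_residue,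
      ← _root_.map_pow, ← _root_.map_mul, ← map_sub, ← map_sub, hE.residue_eq_zero_iff]
    exact h
  · intro c
    obtain ⟨c, rfl⟩ := IsLocalRing.residue_surjective c
    rw [← _root_.map_pow, ← _root_.map_mul, ← map_sub, ← map_sub, ne_eq, hk.residue_eq_zero_iff]
    exact hroot c

section DivisionAlgebra

variable {k D : Type*} [Field k] [DivisionRing D] [Algebra k D] {νk : k → EReal} {νD : D → EReal}
  {q qD : ℕ}

theorem IsLocalValuation.eq_top_or_int (hk : IsLocalValuation k νk 1 q) (c : k) :
    νk c = ⊤ ∨ ∃ m : ℤ, νk c = ((m : ℝ) : EReal) := by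
  by_cases hc : c = 0
  · exact Or.inl (by rw [hc, hk.map_zero])
  · obtain ⟨m, hm⟩ := hk.values c hc
    exact Or.inr ⟨m, by simpa using hm⟩

/-- If `x` and `y` have integral values and `p` has value `1/2`, no cancellation occurs in
`x + y * p`. -/
theorem IsLocalValuation.map_add_mul_le (hD : IsLocalValuation D νD 2 qD) {x y p : D}
    (hx : νD x = ⊤ ∨ ∃ m : ℤ, νD x = ((m : ℝ) : EReal))
    (hy : νD y = ⊤ ∨ ∃ m : ℤ, νD y = ((m : ℝ) : EReal))
    (hp : νD p = (((2 : ℝ)⁻¹ : ℝ) : EReal)) :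
    νD (x + y * p) ≤ νD x ∧ νD (x + y * p) ≤ νD y + νD p := by
  have key : νD x = νD (y * p) → νD x = ⊤ := by
    rcases hx with hx | ⟨m, hm⟩
    · exact fun _ => hx
    · rcases hy with hy | ⟨n, hn⟩
      · intro h
        rw [h, hD.map_mul, hy, hp]
        simp
      · intro h
        rw [hD.map_mul, hm, hn, hp] at h
        norm_cast at h
        have h' : ((2 * m : ℤ) : ℝ) = ((2 * n + 1 : ℤ) : ℝ) := by
          push_cast
          rw [h]
          ring
        have := Int.cast_injective h'
        omega
  rw [← hD.map_mul]
  refine ⟨hD.isUltrametricMap.map_add_le_left key, ?_⟩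
  rw [add_comm]
  exact hD.isUltrametricMap.map_add_le_left fun h => h.trans (key h.symm)

theorem IsLocalValuation.map_smul (hD : IsLocalValuation D νD 2 qD)
    (hcompat : ∀ c : k, νD (algebraMap k D c) = νk c) (c : k) (x : D) :
    νD (c • x) = νk c + νD x := by
  rw [Algebra.smul_def, hD.map_mul, hcompat]

/-- An integral element whose residue is not in the residue field of `k` generates an unramified
quadratic piece on which the valuation is the minimum of the values of the coordinates. -/
theorem IsLocalValuation.map_algebraMap_add_smul (hk : IsLocalValuation k νk 1 q)
    (hD : IsLocalValuation D νD 2 qD) (hcompat : ∀ c : k, νD (algebraMap k D c) = νk c) {u : D}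
    (hu0 : νD u = 0) (hu : ∀ c : k, ¬ 0 < νD (u - algebraMap k D c)) (c d : k) :
    νD (algebraMap k D c + d • u) = min (νk c) (νk d) := by
  have hw := hD.isUltrametricMap
  have hdu : νD (d • u) = νk d := by rw [hD.map_smul hcompat, hu0, add_zero]
  rcases lt_or_ge (νk c) (νk d) with h | h
  · rw [min_eq_left h.le, ← hcompat c]
    exact hw.map_add_of_lt (by rwa [hdu, hcompat])
  · rw [min_eq_right h]
    by_cases hd : d = 0
    · have : c = 0 := by
        rw [← hk.eq_top_iff]
        simpa [hd, hk.map_zero] using h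
      simp [this, hd, hk.map_zero, hD.map_zero]
    · have hcd : algebraMap k D c + d • u = d • (u - algebraMap k D (-(d⁻¹ * c))) := by
        rw [_root_.map_neg, sub_neg_eq_add, smul_add, Algebra.smul_def d (algebraMap k D _),
          ← _root_.map_mul, mul_inv_cancel_left₀ hd, add_comm]
      have h0 : 0 ≤ νk (-(d⁻¹ * c)) := by
        obtain ⟨r, hr⟩ := hk.exists_real hd
        rw [hk.map_neg, hk.map_mul, hk.map_inv hr]
        refine le_trans ?_ (add_le_add_right h _)
        rw [hr]
        norm_cast
        simp
      rw [hcd, hD.map_smul hcompat]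
      have : νD (u - algebraMap k D (-(d⁻¹ * c))) = 0 :=
        le_antisymm (not_lt.1 (hu _)) (hw.le_sub hu0.ge (by rwa [hcompat]))
      rw [this, add_zero]

/-- If every integral element is congruent to an element of `k`, then `D` is spanned by `1` and
an element of value `1/2`. -/
theorem IsLocalValuation.exists_eq_add_smul (hk : IsLocalValuation k νk 1 q)
    (hD : IsLocalValuation D νD 2 qD) (hcompat : ∀ c : k, νD (algebraMap k D c) = νk c) {p : D}
    (hp : νD p = (((2 : ℝ)⁻¹ : ℝ) : EReal))
    (hres : ∀ u : D, 0 ≤ νD u → ∃ c : k, 0 < νD (u - algebraMap k D c)) (t : D) :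
    ∃ a b : k, t = algebraMap k D a + b • p := by
  have hw := hD.isUltrametricMap
  have hmin (a b : k) : νD (algebraMap k D a + b • p) ≤ νk a ∧
      νD (algebraMap k D a + b • p) ≤ νk b + νD p := by
    have := hD.map_add_mul_le (x := algebraMap k D a) (y := algebraMap k D b) (p := p)
      (by rw [hcompat]; exact hk.eq_top_or_int a) (by rw [hcompat]; exact hk.eq_top_or_int b) hp
    rwa [hcompat, hcompat, ← Algebra.smul_def] at this
  obtain ⟨ϖ, hϖ⟩ := hk.exists_uniformizer
  have hϖ : νk ϖ = ((1 : ℝ) : EReal) := by simpa using hϖ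
  have hϖ0 := hk.ne_zero_of_eq hϖ
  have hϖD (n : ℤ) : νD (algebraMap k D (ϖ ^ n)) = ((n : ℝ) : EReal) := by
    rw [hcompat, hk.map_zpow hϖ, mul_one]
  have hp0 := hD.ne_zero_of_eq hp
  have hpos {x : D} (h : 0 < νD x) : (((2 : ℝ)⁻¹ : ℝ) : EReal) ≤ νD x := by
    by_cases hx : x = 0
    · simp [hx, hD.map_zero]
    · obtain ⟨m, hm⟩ := hD.values x hx
      rw [hm] at h ⊢
      simp only [← EReal.coe_zero, EReal.coe_le_coe_iff, EReal.coe_lt_coe_iff] at h ⊢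
      have h' : (0 : ℝ) < m := by
        by_contra! h'
        have := div_nonpos_of_nonpos_of_nonneg h' (show (0 : ℝ) ≤ ((2 : ℕ) : ℝ) by positivity)
        linarith
      have : (1 : ℝ) ≤ m := by exact_mod_cast (show (0 : ℤ) < m by exact_mod_cast h')
      push_cast
      linarith
  have step (m : ℤ) (x : D) (hx : νD x = ((m / 2 : ℝ) : EReal)) :
      ∃ a b : k, (((m + 1) / 2 : ℝ) : EReal) ≤ νD (x - (algebraMap k D a + b • p)) := by
    rcases Int.even_or_odd' m with ⟨n, rfl | rfl⟩
    · obtain ⟨c, hc⟩ := hres (algebraMap k D (ϖ ^ (-n)) * x) (by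
        rw [hD.map_mul, hϖD, hx]
        simp only [← EReal.coe_zero, ← EReal.coe_add, EReal.coe_le_coe_iff]
        push_cast
        linarith)
      refine ⟨ϖ ^ n * c, 0, ?_⟩
      have : x - (algebraMap k D (ϖ ^ n * c) + (0 : k) • p) =
          algebraMap k D (ϖ ^ n) * (algebraMap k D (ϖ ^ (-n)) * x - algebraMap k D c) := by
        rw [mul_sub, ← mul_assoc, ← _root_.map_mul, ← _root_.map_mul, ← zpow_add₀ hϖ0]
        simp
      rw [this, hD.map_mul, hϖD]
      refine le_trans ?_ (add_le_add_right (hpos hc) _)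
      simp only [← EReal.coe_add, EReal.coe_le_coe_iff]
      push_cast
      linarith
    · obtain ⟨c, hc⟩ := hres (algebraMap k D (ϖ ^ (-n)) * x * p⁻¹) (by
        rw [hD.map_mul, hD.map_mul, hϖD, hx, hD.map_inv hp]
        simp only [← EReal.coe_zero, ← EReal.coe_add, EReal.coe_le_coe_iff]
        push_cast
        linarith)
      refine ⟨0, ϖ ^ n * c, ?_⟩
      have : x - (algebraMap k D 0 + (ϖ ^ n * c) • p) =
          algebraMap k D (ϖ ^ n) * (algebraMap k D (ϖ ^ (-n)) * x * p⁻¹ - algebraMap k D c) * p := by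
        rw [mul_assoc, sub_mul, inv_mul_cancel_right₀ hp0, mul_sub, ← mul_assoc, ← mul_assoc,
          ← _root_.map_mul, ← _root_.map_mul, ← zpow_add₀ hϖ0, Algebra.smul_def]
        simp
      rw [this, hD.map_mul, hD.map_mul, hϖD, hp]
      refine le_trans ?_ (add_le_add_left (add_le_add_right (hpos hc) _) _)
      simp only [← EReal.coe_add, EReal.coe_le_coe_iff]
      push_cast
      linarith
  by_cases ht : t = 0
  · exact ⟨0, 0, by simp [ht]⟩
  obtain ⟨m, hm⟩ := hD.values t ht
  have approx (n : ℕ) : ∃ a b : k,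
      (((m + n) / 2 : ℝ) : EReal) ≤ νD (t - (algebraMap k D a + b • p)) := by
    induction n with
    | zero => exact ⟨0, 0, by simp [hm]⟩
    | succ n ih =>
      obtain ⟨a, b, hab⟩ := ih
      set x := t - (algebraMap k D a + b • p) with hx
      by_cases hx0 : x = 0
      · exact ⟨a, b, by rw [← hx, hx0, hD.map_zero]; exact le_top⟩
      · obtain ⟨l, hl⟩ := hD.values x hx0
        obtain ⟨a', b', h⟩ := step l x (by simpa using hl)
        refine ⟨a + a', b + b', ?_⟩
        rw [show t - (algebraMap k D (a + a') + (b + b') • p) =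
          x - (algebraMap k D a' + b' • p) by rw [hx, map_add, add_smul]; abel]
        refine le_trans ?_ h
        rw [hl] at hab
        simp only [EReal.coe_le_coe_iff] at hab ⊢
        push_cast at hab ⊢
        linarith
  choose a b hab using approx
  have hdiff (i j n : ℕ) (hi : n ≤ i) (hj : n ≤ j) : (((m + n) / 2 : ℝ) : EReal) ≤
      νD (algebraMap k D (a i - a j) + (b i - b j) • p) := by
    rw [show algebraMap k D (a i - a j) + (b i - b j) • p =
      (t - (algebraMap k D (a j) + b j • p)) - (t - (algebraMap k D (a i) + b i • p)) by
        rw [map_sub, sub_smul]; abel]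
    refine hw.le_sub (le_trans ?_ (hab j)) (le_trans ?_ (hab i)) <;>
      rw [EReal.coe_le_coe_iff] <;> gcongr
  have hlarge (M : ℝ) : ∃ N : ℕ, M ≤ (m + N) / 2 - 1 := by
    obtain ⟨N, hN⟩ := exists_nat_ge (2 * M + 2 - m)
    exact ⟨N, by linarith⟩
  obtain ⟨α, hα⟩ := hk.complete a fun M => by
    obtain ⟨N, hN⟩ := hlarge M
    refine ⟨N, fun i hi j hj => le_trans ?_ ((hdiff i j N hi hj).trans (hmin _ _).1)⟩
    simp only [EReal.coe_le_coe_iff]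
    linarith
  obtain ⟨β, hβ⟩ := hk.complete b fun M => by
    obtain ⟨N, hN⟩ := hlarge M
    refine ⟨N, fun i hi j hj => ?_⟩
    have h := (hdiff i j N hi hj).trans (hmin _ _).2
    by_cases h0 : b i - b j = 0
    · simp [h0, hk.map_zero]
    · obtain ⟨r, hr⟩ := hk.exists_real h0
      rw [hr, hp] at h
      rw [hr]
      simp only [← EReal.coe_add, EReal.coe_le_coe_iff] at h ⊢
      linarith
  refine ⟨α, β, ?_⟩
  rw [← sub_eq_zero, ← hD.eq_top_iff, EReal.eq_top_iff_forall_lt]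
  intro M
  obtain ⟨N₁, hN₁⟩ := hα (M + 1)
  obtain ⟨N₂, hN₂⟩ := hβ (M + 1)
  obtain ⟨N₃, hN₃⟩ := hlarge (M + 1)
  set n := max N₁ (max N₂ N₃) with hn
  refine lt_of_lt_of_le (b := ((M + 1 : ℝ) : EReal)) (by rw [EReal.coe_lt_coe_iff]; linarith) ?_
  rw [show t - (algebraMap k D α + β • p) = (t - (algebraMap k D (a n) + b n • p)) +
    (algebraMap k D (a n - α) + (b n - β) • p) by rw [map_sub, sub_smul]; abel]
  refine hw.le_add ?_ (hw.le_add ?_ ?_)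
  · refine le_trans ?_ (hab n)
    have : (N₃ : ℝ) ≤ n := by exact_mod_cast (by omega : N₃ ≤ n)
    simp only [EReal.coe_le_coe_iff]
    linarith
  · rw [hcompat]
    exact hN₁ n (by omega)
  · rw [hD.map_smul hcompat, hp]
    refine (hN₂ n (by omega)).trans (le_add_of_nonneg_right ?_)
    simp only [← EReal.coe_zero, EReal.coe_le_coe_iff]
    positivity

theorem IsLocalValuation.exists_residue_generator (hk : IsLocalValuation k νk 1 q)
    (hD : IsLocalValuation D νD 2 qD) (hcompat : ∀ c : k, νD (algebraMap k D c) = νk c)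
    (hdim : 2 < Module.finrank k D) :
    ∃ u : D, 0 ≤ νD u ∧ ∀ c : k, ¬ 0 < νD (u - algebraMap k D c) := by
  by_contra! hres
  obtain ⟨p, hp⟩ := hD.exists_uniformizer
  have hspan : Submodule.span k (Set.range ![1, p]) = ⊤ := by
    refine Submodule.eq_top_iff'.2 fun t => ?_
    obtain ⟨a, b, rfl⟩ := hk.exists_eq_add_smul hD hcompat (by exact_mod_cast hp) hres t
    rw [Algebra.algebraMap_eq_smul_one]
    exact add_mem (Submodule.smul_mem _ _ (Submodule.subset_span ⟨0, rfl⟩))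
      (Submodule.smul_mem _ _ (Submodule.subset_span ⟨1, rfl⟩))
  have := finrank_range_le_card (R := k) ![1, p]
  rw [Set.finrank, hspan, finrank_top, Fintype.card_fin] at this
  omega

/-- A quaternion division algebra of ramification index `2` has a basis `1, u, p, u * p` splitting
the valuation, where `u` generates a quadratic extension of the residue field of `k`. -/
theorem IsLocalValuation.exists_splitting_basis (hk : IsLocalValuation k νk 1 q)
    (hD : IsLocalValuation D νD 2 qD) (hcompat : ∀ c : k, νD (algebraMap k D c) = νk c)
    (hdim : Module.finrank k D = 4) {p : D} (hp : νD p = (((2 : ℝ)⁻¹ : ℝ) : EReal)) :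
    ∃ (u : D) (B : Module.Basis (Fin 4) k D) (a b : k), ⇑B = ![1, u, p, u * p] ∧
      (∀ (c : Fin 4 → k) (i : Fin 4), νD (∑ j, c j • B j) ≤ νk (c i) + νD (B i)) ∧
      νD u = 0 ∧ 0 ≤ νk a ∧ 0 ≤ νk b ∧
      0 < νD (u ^ 2 - (algebraMap k D a * u + algebraMap k D b)) ∧
      ∀ c : k, ¬ 0 < νk (c ^ 2 - a * c - b) := by
  have hw := hD.isUltrametricMap
  obtain ⟨u, hu, hures⟩ := hk.exists_residue_generator hD hcompat (by omega)
  have hu0 : νD u = 0 := le_antisymm (by simpa using hures 0) hu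
  have hmin := hk.map_algebraMap_add_smul hD hcompat hu0 hures
  have hint (c d : k) : νD (algebraMap k D c + d • u) = ⊤ ∨
      ∃ m : ℤ, νD (algebraMap k D c + d • u) = ((m : ℝ) : EReal) := by
    rw [hmin]
    rcases min_choice (νk c) (νk d) with h | h <;> rw [h] <;> exact hk.eq_top_or_int _
  have hexp (c : Fin 4 → k) : ∑ j, c j • (![1, u, p, u * p] : Fin 4 → D) j =
      (algebraMap k D (c 0) + c 1 • u) + (algebraMap k D (c 2) + c 3 • u) * p := by
    simp only [Fin.sum_univ_four, Algebra.algebraMap_eq_smul_one, add_mul, smul_mul_assoc, one_mul]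
    simp
    abel
  have hsplit (c : Fin 4 → k) (i : Fin 4) :
      νD (∑ j, c j • (![1, u, p, u * p] : Fin 4 → D) j) ≤
        νk (c i) + νD ((![1, u, p, u * p] : Fin 4 → D) i) := by
    rw [hexp]
    obtain ⟨h1, h2⟩ := hD.map_add_mul_le (hint (c 0) (c 1)) (hint (c 2) (c 3)) hp
    rw [hmin] at h1 h2
    fin_cases i
    · simpa [hD.map_one] using h1.trans (min_le_left _ _)
    · simpa [hu0] using h1.trans (min_le_right _ _)
    · exact h2.trans (add_le_add_left (min_le_left _ _) _)
    · simpa [hD.map_mul, hu0] using h2.trans (add_le_add_left (min_le_right _ _) _)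
  have hfin (i : Fin 4) : νD ((![1, u, p, u * p] : Fin 4 → D) i) ≠ ⊤ := by
    fin_cases i <;> simp [hD.map_one, hD.map_mul, hu0, hp]
  have hli : LinearIndependent k (![1, u, p, u * p] : Fin 4 → D) := by
    rw [Fintype.linearIndependent_iff]
    intro c hc i
    have h := hsplit c i
    rw [hc, hD.map_zero, top_le_iff] at h
    by_contra hci
    obtain ⟨r, hr⟩ := hk.exists_real hci
    rw [hr] at h
    obtain ⟨s, hs⟩ := hD.exists_real (fun h0 => hfin i ((hD.eq_top_iff _).2 h0))
    rw [hs] at h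
    exact EReal.coe_ne_top _ h
  let B := basisOfLinearIndependentOfCardEqFinrank hli (by simp [hdim])
  have hB : ⇑B = ![1, u, p, u * p] := coe_basisOfLinearIndependentOfCardEqFinrank _ _
  set c := B.repr (u ^ 2) with hc
  have hrep : u ^ 2 = (algebraMap k D (c 0) + c 1 • u) + (algebraMap k D (c 2) + c 3 • u) * p := by
    rw [← hexp, ← hB, hc, B.sum_repr]
  have hu2 : νD (u ^ 2) = 0 := by rw [pow_two, hD.map_mul, hu0, add_zero]
  obtain ⟨h1, h2⟩ := hD.map_add_mul_le (hint (c 0) (c 1)) (hint (c 2) (c 3)) hp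
  rw [← hrep, hu2] at h1 h2
  have h3 := h1
  rw [hmin, le_min_iff] at h3
  have hpos : 0 < νD (u ^ 2 - (algebraMap k D (c 1) * u + algebraMap k D (c 0))) := by
    have : u ^ 2 - (algebraMap k D (c 1) * u + algebraMap k D (c 0)) =
        (algebraMap k D (c 2) + c 3 • u) * p := by
      nth_rw 1 [hrep]
      rw [Algebra.smul_def]
      abel
    rw [this, hD.map_mul]
    rcases hint (c 2) (c 3) with h | ⟨m, h⟩
    · simp [h, hp]
    · rw [h, hp] at h2 ⊢
      simp only [← EReal.coe_zero, ← EReal.coe_add, EReal.coe_le_coe_iff, EReal.coe_lt_coe_iff]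
        at h2 ⊢
      have : (-1 : ℝ) < m := by linarith
      have : (0 : ℝ) ≤ m := by exact_mod_cast (by exact_mod_cast this : (-1 : ℤ) < m)
      linarith
  refine ⟨u, B, c 1, c 0, hB, fun c i => ?_, hu0, h3.2, h3.1, hpos, fun x hx => ?_⟩
  · rw [hB]
    exact hsplit c i
  · rw [← hcompat] at hx
    have h := hw.lt_sub hpos hx
    have : u ^ 2 - (algebraMap k D (c 1) * u + algebraMap k D (c 0)) -
        algebraMap k D (x ^ 2 - c 1 * x - c 0) =
        (u - algebraMap k D x) * (u - algebraMap k D (c 1 - x)) := by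
      have h1 := Algebra.commutes x u
      have h2 := Algebra.commutes (c 1) u
      have h3 : algebraMap k D x * algebraMap k D (c 1) =
        algebraMap k D (c 1) * algebraMap k D x := Algebra.commutes _ _
      simp only [map_sub, _root_.map_mul, pow_two, mul_sub, sub_mul]
      rw [h1, h2, h3]
      abel
    rw [this, hD.map_mul] at h
    exact absurd h (not_lt.2 (add_nonpos (not_lt.1 (hures _)) (not_lt.1 (hures _))))

end DivisionAlgebra
section TensorProduct

variable {k E D : Type*} [Field k] [Field E] [Algebra k E] [DivisionRing D] [Algebra k D]
  {νk : k → EReal} {νE : E → EReal} {νD : D → EReal} {e q qE qD n : ℕ}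

theorem sum_repr_baseChange (B : Module.Basis (Fin n) k D) (t : E ⊗[k] D) :
    ∑ i, (B.baseChange E).repr t i ⊗ₜ[k] B i = t := by
  conv_rhs => rw [← (B.baseChange E).sum_repr t]
  simp [TensorProduct.smul_tmul']

theorem tensorVal_eq_iInf (hE : IsLocalValuation E νE e qE) (hD : IsLocalValuation D νD 2 qD)
    (hcompatE : ∀ c : k, νE (algebraMap k E c) = νk c) {B : Module.Basis (Fin n) k D}
    (hB : ∀ (c : Fin n → k) (i : Fin n), νD (∑ j, c j • B j) ≤ νk (c i) + νD (B i))
    (t : E ⊗[k] D) :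
    tensorVal k νE νD t = ⨅ i, (νE ((B.baseChange E).repr t i) + νD (B i)) := by
  apply le_antisymm
  · refine sSup_le ?_
    rintro _ ⟨m, x, y, rfl, rfl⟩
    refine le_iInf fun i => ?_
    have key : IsUltrametricMap fun z => νE z + νD (B i) := by
      refine ⟨?_, fun z => by simp only [hE.map_neg], fun x y => ?_⟩
      · rw [hE.map_zero, EReal.top_add_of_ne_bot (hD.ne_bot _)]
      · rw [min_add_add_right]
        exact add_le_add_left (hE.min_le_add x y) _
    rw [map_sum, Finsupp.finsetSum_apply]
    refine key.le_sum _ fun j _ => (iInf_le _ j).trans ?_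
    rw [Module.Basis.baseChange_repr_tmul, Algebra.smul_def, hE.map_mul, hcompatE, add_comm (νk _),
      add_assoc]
    refine add_le_add_right ?_ _
    conv_lhs => rw [← B.sum_repr (y j)]
    exact hB _ i
  · exact le_sSup ⟨n, _, _, (sum_repr_baseChange B t).symm, rfl⟩

theorem le_tensorVal_iff (hE : IsLocalValuation E νE e qE) (hD : IsLocalValuation D νD 2 qD)
    (hcompatE : ∀ c : k, νE (algebraMap k E c) = νk c) {B : Module.Basis (Fin n) k D}
    (hB : ∀ (c : Fin n → k) (i : Fin n), νD (∑ j, c j • B j) ≤ νk (c i) + νD (B i))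
    {t : E ⊗[k] D} {r : EReal} :
    r ≤ tensorVal k νE νD t ↔ ∀ i, r ≤ νE ((B.baseChange E).repr t i) + νD (B i) := by
  rw [tensorVal_eq_iInf hE hD hcompatE hB, le_iInf_iff]

theorem isUltrametricMap_tensorVal (hE : IsLocalValuation E νE e qE)
    (hD : IsLocalValuation D νD 2 qD)
    (hcompatE : ∀ c : k, νE (algebraMap k E c) = νk c) {B : Module.Basis (Fin n) k D}
    (hB : ∀ (c : Fin n → k) (i : Fin n), νD (∑ j, c j • B j) ≤ νk (c i) + νD (B i)) :
    IsUltrametricMap (tensorVal k νE νD : E ⊗[k] D → EReal) := by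
  refine ⟨?_, fun t => ?_, fun t s => ?_⟩
  · rw [← top_le_iff, le_tensorVal_iff hE hD hcompatE hB]
    simp [hE.map_zero, EReal.top_add_of_ne_bot (hD.ne_bot _)]
  · simp [tensorVal_eq_iInf hE hD hcompatE hB, hE.map_neg]
  · rw [le_tensorVal_iff hE hD hcompatE hB]
    intro i
    have ht := (le_tensorVal_iff hE hD hcompatE hB (t := t)).1 le_rfl i
    have hs := (le_tensorVal_iff hE hD hcompatE hB (t := s)).1 le_rfl i
    refine (min_le_min ht hs).trans ?_
    rw [min_add_add_right]
    refine add_le_add_left ?_ _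
    simpa using hE.min_le_add _ _

theorem tensorVal_tmul (hE : IsLocalValuation E νE e qE) (hD : IsLocalValuation D νD 2 qD)
    (hcompatE : ∀ c : k, νE (algebraMap k E c) = νk c)
    (hcompatD : ∀ c : k, νD (algebraMap k D c) = νk c) [NeZero n] {B : Module.Basis (Fin n) k D}
    (hB : ∀ (c : Fin n → k) (i : Fin n), νD (∑ j, c j • B j) ≤ νk (c i) + νD (B i))
    (x : E) (y : D) : tensorVal k νE νD (x ⊗ₜ[k] y) = νE x + νD y := by
  have hrepr (i : Fin n) : νE ((B.baseChange E).repr (x ⊗ₜ[k] y) i) + νD (B i) =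
      νE x + (νk (B.repr y i) + νD (B i)) := by
    rw [Module.Basis.baseChange_repr_tmul, Algebra.smul_def, hE.map_mul, hcompatE, add_comm (νk _),
      add_assoc]
  apply le_antisymm
  · obtain ⟨i, hi⟩ := exists_eq_ciInf_of_finite (f := fun i => νk (B.repr y i) + νD (B i))
    refine ((le_tensorVal_iff hE hD hcompatE hB).1 le_rfl i).trans ?_
    rw [hrepr]
    refine add_le_add_right ?_ _
    rw [hi]
    conv_rhs => rw [← B.sum_repr y]
    refine hD.isUltrametricMap.le_sum _ fun j _ => (iInf_le _ j).trans ?_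
    rw [hD.map_smul hcompatD]
  · rw [le_tensorVal_iff hE hD hcompatE hB]
    intro i
    rw [hrepr]
    refine add_le_add_right ?_ _
    conv_lhs => rw [← B.sum_repr y]
    exact hB _ i

theorem tensorVal_add_le_mul (hE : IsLocalValuation E νE e qE) (hD : IsLocalValuation D νD 2 qD)
    (hcompatE : ∀ c : k, νE (algebraMap k E c) = νk c)
    (hcompatD : ∀ c : k, νD (algebraMap k D c) = νk c) [NeZero n] {B : Module.Basis (Fin n) k D}
    (hB : ∀ (c : Fin n → k) (i : Fin n), νD (∑ j, c j • B j) ≤ νk (c i) + νD (B i))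
    (t s : E ⊗[k] D) :
    tensorVal k νE νD t + tensorVal k νE νD s ≤ tensorVal k νE νD (t * s) := by
  have hw := isUltrametricMap_tensorVal hE hD hcompatE hB
  have key : t * s = ∑ i, ∑ j, ((B.baseChange E).repr t i * (B.baseChange E).repr s j) ⊗ₜ[k]
      (B i * B j) := by
    conv_lhs => rw [← sum_repr_baseChange B t, ← sum_repr_baseChange B s, Finset.sum_mul_sum]
    simp
  rw [key]
  refine hw.le_sum _ fun i _ => hw.le_sum _ fun j _ => ?_
  rw [tensorVal_tmul hE hD hcompatE hcompatD hB, hE.map_mul, hD.map_mul, add_add_add_comm]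
  exact add_le_add ((le_tensorVal_iff hE hD hcompatE hB).1 le_rfl i)
    ((le_tensorVal_iff hE hD hcompatE hB).1 le_rfl j)

theorem tensorVal_eq_top_iff (hE : IsLocalValuation E νE e qE) (hD : IsLocalValuation D νD 2 qD)
    (hcompatE : ∀ c : k, νE (algebraMap k E c) = νk c) {B : Module.Basis (Fin n) k D}
    (hB : ∀ (c : Fin n → k) (i : Fin n), νD (∑ j, c j • B j) ≤ νk (c i) + νD (B i))
    (t : E ⊗[k] D) : tensorVal k νE νD t = ⊤ ↔ t = 0 := by
  refine ⟨fun h => ?_, fun h => by rw [h, (isUltrametricMap_tensorVal hE hD hcompatE hB).map_zero]⟩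
  rw [← sum_repr_baseChange B t]
  refine Finset.sum_eq_zero fun i _ => ?_
  have := (le_tensorVal_iff hE hD hcompatE hB).1 h.ge i
  obtain ⟨r, hr⟩ := hD.exists_real (B.ne_zero i)
  by_contra h0
  obtain ⟨s, hs⟩ := hE.exists_real (x := (B.baseChange E).repr t i)
    (fun h' => h0 (by rw [h', TensorProduct.zero_tmul]))
  rw [hr, hs] at this
  exact EReal.coe_ne_top _ (top_le_iff.1 this)

/-- Every value of `ν⊗ν` on a nonzero element is attained on a pure tensor. -/
theorem exists_tensorVal_eq (hE : IsLocalValuation E νE e qE) (hD : IsLocalValuation D νD 2 qD)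
    (hcompatE : ∀ c : k, νE (algebraMap k E c) = νk c) [NeZero n] {B : Module.Basis (Fin n) k D}
    (hB : ∀ (c : Fin n → k) (i : Fin n), νD (∑ j, c j • B j) ≤ νk (c i) + νD (B i))
    {t : E ⊗[k] D} (ht : t ≠ 0) :
    ∃ (x : E) (y : D), x ≠ 0 ∧ y ≠ 0 ∧ tensorVal k νE νD t = νE x + νD y := by
  obtain ⟨i, hi⟩ := exists_eq_ciInf_of_finite
    (f := fun i => νE ((B.baseChange E).repr t i) + νD (B i))
  rw [← tensorVal_eq_iInf hE hD hcompatE hB] at hi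
  refine ⟨_, B i, fun h => ht ?_, B.ne_zero i, hi.symm⟩
  rw [← tensorVal_eq_top_iff hE hD hcompatE hB, ← hi, h, hE.map_zero,
    EReal.top_add_of_ne_bot (hD.ne_bot _)]

theorem tensorVal_tmul_mul (hE : IsLocalValuation E νE e qE) (hD : IsLocalValuation D νD 2 qD)
    (hcompatE : ∀ c : k, νE (algebraMap k E c) = νk c)
    (hcompatD : ∀ c : k, νD (algebraMap k D c) = νk c) [NeZero n] {B : Module.Basis (Fin n) k D}
    (hB : ∀ (c : Fin n → k) (i : Fin n), νD (∑ j, c j • B j) ≤ νk (c i) + νD (B i))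
    {x : E} {y : D} (hx : x ≠ 0) (hy : y ≠ 0) (t : E ⊗[k] D) :
    tensorVal k νE νD (x ⊗ₜ[k] y * t) = νE x + νD y + tensorVal k νE νD t := by
  obtain ⟨r, hr⟩ := hE.exists_real hx
  obtain ⟨s, hs⟩ := hD.exists_real hy
  apply le_antisymm
  · have h := tensorVal_add_le_mul hE hD hcompatE hcompatD hB (x⁻¹ ⊗ₜ[k] y⁻¹) (x ⊗ₜ[k] y * t)
    rw [← mul_assoc, Algebra.TensorProduct.tmul_mul_tmul, inv_mul_cancel₀ hx, inv_mul_cancel₀ hy,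
      ← Algebra.TensorProduct.one_def, one_mul, tensorVal_tmul hE hD hcompatE hcompatD hB,
      hE.map_inv hr, hD.map_inv hs] at h
    rw [hr, hs]
    refine le_trans ?_ (add_le_add_right h _)
    rw [← add_assoc, ← EReal.coe_add, ← EReal.coe_add, ← EReal.coe_add,
      show r + s + (-r + -s) = 0 by ring, EReal.coe_zero, zero_add]
  · rw [← tensorVal_tmul hE hD hcompatE hcompatD hB]
    exact tensorVal_add_le_mul hE hD hcompatE hcompatD hB _ _

theorem IsLocalValuation.one_sub_div_two_le (hE : IsLocalValuation E νE e qE) (he : Odd e) {x : E}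
    (hx : 0 ≤ νE x + (((2 : ℝ)⁻¹ : ℝ) : EReal)) :
    (((((1 - (e : ℤ)) / 2 : ℤ) : ℝ) * (e : ℝ)⁻¹ : ℝ) : EReal) ≤ νE x := by
  by_cases h0 : x = 0
  · simp [h0, hE.map_zero]
  obtain ⟨m, hm⟩ := hE.values x h0
  have hepos : (0 : ℝ) < e := by exact_mod_cast hE.e_pos
  obtain ⟨l, hl⟩ := he
  rw [hm] at hx ⊢
  simp only [← EReal.coe_zero, ← EReal.coe_add, EReal.coe_le_coe_iff] at hx ⊢
  rw [← div_eq_mul_inv]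
  gcongr
  have h1 : (0 : ℝ) ≤ ((2 * m + e : ℤ) : ℝ) := by
    have : ((2 * m + e : ℤ) : ℝ) = 2 * e * (m / e + 2⁻¹) := by
      push_cast
      field_simp
    rw [this]
    positivity
  have h2 : (0 : ℤ) ≤ 2 * m + e := by exact_mod_cast h1
  omega

theorem one_sub_div_two_add_half {e : ℕ} (he : Odd e) :
    (((1 - (e : ℤ)) / 2 : ℤ) : ℝ) * (e : ℝ)⁻¹ + 2⁻¹ = 1 / (2 * e) := by
  obtain ⟨l, rfl⟩ := he
  rw [show (1 - ((2 * l + 1 : ℕ) : ℤ)) / 2 = -l by push_cast; omega]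
  push_cast
  field_simp
  ring

theorem IsLocalValuation.pos_add_half (hE : IsLocalValuation E νE e qE) (he : Odd e) {x : E}
    (hx : 0 ≤ νE x + (((2 : ℝ)⁻¹ : ℝ) : EReal)) : 0 < νE x + (((2 : ℝ)⁻¹ : ℝ) : EReal) := by
  refine lt_of_lt_of_le ?_ (add_le_add_left (hE.one_sub_div_two_le he hx) _)
  rw [← EReal.coe_add, one_sub_div_two_add_half he, EReal.coe_pos]
  have : (0 : ℝ) < e := by exact_mod_cast hE.e_pos
  positivity

/-- The quadratic form `x ^ 2 + a * x * y - b * y ^ 2` is anisotropic modulo the maximal ideal as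
soon as `X ^ 2 - a * X - b` has no root there. -/
theorem IsLocalValuation.map_quadratic_eq_zero (hE : IsLocalValuation E νE e qE) {a b x y : E} (ha : 0 ≤ νE a)
    (hb : 0 ≤ νE b) (hroot : ∀ z, 0 ≤ νE z → ¬ 0 < νE (z ^ 2 - a * z - b))
    (hx : 0 ≤ νE x) (hy : 0 ≤ νE y) (hxy : νE x = 0 ∨ νE y = 0) :
    νE (x ^ 2 + a * x * y - b * y ^ 2) = 0 := by
  have hw := hE.isUltrametricMap
  rcases hy.eq_or_lt with hy0 | hy0
  · have hy0' : νE y = ((0 : ℝ) : EReal) := by simpa using hy0.symm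
    have hyne := hE.ne_zero_of_eq hy0'
    have hz : 0 ≤ νE (-(x * y⁻¹)) := by
      rw [hE.map_neg, hE.map_mul, hE.map_inv hy0']
      simpa using hx
    have hfac : x ^ 2 + a * x * y - b * y ^ 2 =
        y ^ 2 * ((-(x * y⁻¹)) ^ 2 - a * (-(x * y⁻¹)) - b) := by
      field_simp
      ring
    rw [hfac, hE.map_mul, hE.map_pow hy0']
    have : νE ((-(x * y⁻¹)) ^ 2 - a * (-(x * y⁻¹)) - b) = 0 := by
      refine le_antisymm (not_lt.1 (hroot _ hz)) (hw.le_sub (hw.le_sub ?_ (hE.le_mul ha hz)) hb)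
      rw [pow_two]
      exact hE.le_mul hz hz
    rw [this]
    simp
  · have hx0 : νE x = 0 := hxy.resolve_right hy0.ne'
    have hx2 : νE (x ^ 2) = 0 := by rw [pow_two, hE.map_mul, hx0, add_zero]
    have hpos : 0 < νE ((a * x - b * y) * y) := by
      rw [hE.map_mul]
      refine hy0.trans_le (le_add_of_nonneg_left (hw.le_sub (hE.le_mul ha hx) (hE.le_mul hb hy)))
    rw [show x ^ 2 + a * x * y - b * y ^ 2 = x ^ 2 + (a * x - b * y) * y by ring,
      hw.map_add_of_lt (by rwa [hx2]), hx2]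

/-- An element of value `0` is, up to an error of positive value, invertible up to a unit
of `E`. -/
theorem exists_mul_sub_tmul_one_pos (hE : IsLocalValuation E νE e qE)
    (hD : IsLocalValuation D νD 2 qD)
    (hcompatE : ∀ c : k, νE (algebraMap k E c) = νk c)
    (hcompatD : ∀ c : k, νD (algebraMap k D c) = νk c) (he : Odd e) {u p : D} {a b : k}
    {B : Module.Basis (Fin 4) k D}
    (hB : ∀ (c : Fin 4 → k) (i : Fin 4), νD (∑ j, c j • B j) ≤ νk (c i) + νD (B i))
    (hBu : ⇑B = ![1, u, p, u * p]) (hu : νD u = 0) (hp : νD p = (((2 : ℝ)⁻¹ : ℝ) : EReal))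
    (ha : 0 ≤ νk a) (hb : 0 ≤ νk b)
    (hquad : 0 < νD (u ^ 2 - (algebraMap k D a * u + algebraMap k D b)))
    (hroot : ∀ z, 0 ≤ νE z → ¬ 0 < νE (z ^ 2 - algebraMap k E a * z - algebraMap k E b))
    {t : E ⊗[k] D} (ht : tensorVal k νE νD t = 0) :
    ∃ (t' : E ⊗[k] D) (N : E), 0 ≤ tensorVal k νE νD t' ∧ νE N = 0 ∧
      0 < tensorVal k νE νD (t' * t - N ⊗ₜ[k] 1) := by
  have hw := isUltrametricMap_tensorVal hE hD hcompatE hB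
  have hmul := tensorVal_tmul hE hD hcompatE hcompatD hB
  have hle := tensorVal_add_le_mul hE hD hcompatE hcompatD hB
  set c := fun i => (B.baseChange E).repr t i with hc
  have ht4 : t = c 0 ⊗ₜ[k] 1 + c 1 ⊗ₜ[k] u + (c 2 ⊗ₜ[k] p + c 3 ⊗ₜ[k] (u * p)) := by
    rw [← sum_repr_baseChange B t, Fin.sum_univ_four, hBu]
    simp [hc, add_assoc]
  have hci := (le_tensorVal_iff hE hD hcompatE hB).1 ht.ge
  have h0 : 0 ≤ νE (c 0) := by simpa [hBu, hD.map_one] using hci 0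
  have h1 : 0 ≤ νE (c 1) := by simpa [hBu, hu] using hci 1
  have h2 : 0 < νE (c 2) + (((2 : ℝ)⁻¹ : ℝ) : EReal) :=
    hE.pos_add_half he (by simpa [hBu, hp] using hci 2)
  have h3 : 0 < νE (c 3) + (((2 : ℝ)⁻¹ : ℝ) : EReal) :=
    hE.pos_add_half he (by simpa [hBu, hD.map_mul, hu, hp] using hci 3)
  have hodd : 0 < tensorVal k νE νD (c 2 ⊗ₜ[k] p + c 3 ⊗ₜ[k] (u * p)) := by
    refine hw.lt_add ?_ ?_
    · rwa [hmul, hp]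
    · rwa [hmul, hD.map_mul, hu, hp, zero_add]
  have hunit : νE (c 0) = 0 ∨ νE (c 1) = 0 := by
    by_contra! h
    have : 0 < tensorVal k νE νD t := by
      rw [ht4]
      refine hw.lt_add (hw.lt_add ?_ ?_) hodd
      · rw [hmul, hD.map_one, add_zero]
        exact lt_of_le_of_ne h0 (Ne.symm h.1)
      · rw [hmul, hu, add_zero]
        exact lt_of_le_of_ne h1 (Ne.symm h.2)
    exact this.ne' ht
  have haE : 0 ≤ νE (algebraMap k E a) := by rwa [hcompatE]
  have hbE : 0 ≤ νE (algebraMap k E b) := by rwa [hcompatE]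
  have ht' : 0 ≤ tensorVal k νE νD
      ((c 0 + algebraMap k E a * c 1) ⊗ₜ[k] 1 - c 1 ⊗ₜ[k] u : E ⊗[k] D) := by
    refine hw.le_sub ?_ ?_
    · rw [hmul, hD.map_one, add_zero]
      exact hE.isUltrametricMap.le_add h0 (hE.le_mul haE h1)
    · rwa [hmul, hu, add_zero]
  refine ⟨_, _, ht', hE.map_quadratic_eq_zero haE hbE hroot h0 h1 hunit, ?_⟩
  set ε := u ^ 2 - (algebraMap k D a * u + algebraMap k D b) with hε
  have huu : u * u = a • u + b • 1 + ε := by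
    rw [hε, Algebra.smul_def, Algebra.smul_def, mul_one, pow_two]
    abel
  have hprod : ((c 0 + algebraMap k E a * c 1) ⊗ₜ[k] 1 - c 1 ⊗ₜ[k] u : E ⊗[k] D) *
      (c 0 ⊗ₜ[k] 1 + c 1 ⊗ₜ[k] u) - (c 0 ^ 2 + algebraMap k E a * c 0 * c 1 -
        algebraMap k E b * c 1 ^ 2) ⊗ₜ[k] 1 = -((c 1 * c 1) ⊗ₜ[k] ε) := by
    simp only [sub_mul, mul_add, Algebra.TensorProduct.tmul_mul_tmul, one_mul, mul_one, huu,
      TensorProduct.tmul_add, TensorProduct.tmul_smul, TensorProduct.smul_tmul',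
      TensorProduct.sub_tmul, TensorProduct.add_tmul, add_mul]
    simp only [Algebra.smul_def, pow_two, mul_assoc, mul_comm (c 1) (c 0)]
    abel
  have hfin : ((c 0 + algebraMap k E a * c 1) ⊗ₜ[k] 1 - c 1 ⊗ₜ[k] u : E ⊗[k] D) * t -
      (c 0 ^ 2 + algebraMap k E a * c 0 * c 1 - algebraMap k E b * c 1 ^ 2) ⊗ₜ[k] 1 =
      -((c 1 * c 1) ⊗ₜ[k] ε) + ((c 0 + algebraMap k E a * c 1) ⊗ₜ[k] 1 - c 1 ⊗ₜ[k] u) *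
        (c 2 ⊗ₜ[k] p + c 3 ⊗ₜ[k] (u * p)) := by
    rw [← hprod]
    nth_rw 1 [ht4]
    rw [mul_add]
    abel
  rw [hfin]
  refine hw.lt_add ?_ (lt_of_lt_of_le ?_ (hle _ _))
  · rw [hw.map_neg, hmul]
    exact hquad.trans_le (le_add_of_nonneg_left (hE.le_mul h1 h1))
  · exact hodd.trans_le (le_add_of_nonneg_left ht')

/-- `ν⊗ν` is multiplicative as soon as every element of value `0` is invertible up to an error of
positive value and a unit of `E`. -/
theorem tensorVal_mul (hE : IsLocalValuation E νE e qE) (hD : IsLocalValuation D νD 2 qD)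
    (hcompatE : ∀ c : k, νE (algebraMap k E c) = νk c)
    (hcompatD : ∀ c : k, νD (algebraMap k D c) = νk c) [NeZero n] {B : Module.Basis (Fin n) k D}
    (hB : ∀ (c : Fin n → k) (i : Fin n), νD (∑ j, c j • B j) ≤ νk (c i) + νD (B i))
    (hinv : ∀ t : E ⊗[k] D, tensorVal k νE νD t = 0 → ∃ (t' : E ⊗[k] D) (N : E),
      0 ≤ tensorVal k νE νD t' ∧ νE N = 0 ∧ 0 < tensorVal k νE νD (t' * t - N ⊗ₜ[k] 1))
    (t s : E ⊗[k] D) :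
    tensorVal k νE νD (t * s) = tensorVal k νE νD t + tensorVal k νE νD s := by
  have hw := isUltrametricMap_tensorVal hE hD hcompatE hB
  have hle := tensorVal_add_le_mul hE hD hcompatE hcompatD hB
  have hsc (x : E) (y : D) (hx : x ≠ 0) (hy : y ≠ 0) (t : E ⊗[k] D) :=
    tensorVal_tmul_mul hE hD hcompatE hcompatD hB hx hy t
  have hreal {t : E ⊗[k] D} (ht : t ≠ 0) : ∃ r : ℝ, tensorVal k νE νD t = r := by
    obtain ⟨x, y, hx, hy, h⟩ := exists_tensorVal_eq hE hD hcompatE hB ht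
    obtain ⟨r, hr⟩ := hE.exists_real hx
    obtain ⟨s, hs⟩ := hD.exists_real hy
    exact ⟨r + s, by rw [h, hr, hs, EReal.coe_add]⟩
  have hne_bot (t : E ⊗[k] D) : tensorVal k νE νD t ≠ ⊥ := by
    by_cases ht : t = 0
    · simp [ht, hw.map_zero]
    · obtain ⟨r, hr⟩ := hreal ht
      simp [hr]
  by_cases ht : t = 0
  · rw [ht, zero_mul, hw.map_zero, EReal.top_add_of_ne_bot (hne_bot s)]
  by_cases hs : s = 0
  · rw [hs, mul_zero, hw.map_zero, EReal.add_top_of_ne_bot (hne_bot t)]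
  have hunit (t : E ⊗[k] D) (ht : tensorVal k νE νD t = 0) :
      tensorVal k νE νD (t * s) = tensorVal k νE νD s := by
    obtain ⟨t', N, ht', hN, hr⟩ := hinv t ht
    obtain ⟨r, hr'⟩ := hreal hs
    refine le_antisymm ?_ (by simpa [ht] using hle t s)
    have hN0 : N ≠ 0 := hE.ne_zero_of_eq (r := 0) (by simpa using hN)
    have h1 : tensorVal k νE νD (N ⊗ₜ[k] 1 * s) = tensorVal k νE νD s := by
      rw [hsc _ _ hN0 one_ne_zero, hN, hD.map_one, zero_add, zero_add]
    have h2 : tensorVal k νE νD s < tensorVal k νE νD ((t' * t - N ⊗ₜ[k] 1) * s) := by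
      refine lt_of_lt_of_le ?_ (hle _ _)
      rw [hr']
      simpa using EReal.add_lt_add_right_coe hr r
    have h3 : tensorVal k νE νD (t' * (t * s)) = tensorVal k νE νD s := by
      rw [← h1, ← hw.map_add_of_lt (h1.trans_lt h2)]
      congr 1
      rw [sub_mul, mul_assoc]
      abel
    rw [← h3]
    exact (le_add_of_nonneg_left ht').trans (hle _ _)
  obtain ⟨x, y, hx, hy, hxy⟩ := exists_tensorVal_eq hE hD hcompatE hB ht
  obtain ⟨r, hr⟩ := hE.exists_real hx
  obtain ⟨r', hr'⟩ := hD.exists_real hy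
  have hxi : νE x⁻¹ + νD y⁻¹ = ((-(r + r') : ℝ) : EReal) := by
    rw [hE.map_inv hr, hD.map_inv hr', ← EReal.coe_add]
    congr 1
    ring
  rw [hr, hr', ← EReal.coe_add] at hxy
  have h := hunit (x⁻¹ ⊗ₜ[k] y⁻¹ * t) (by
    rw [hsc _ _ (inv_ne_zero hx) (inv_ne_zero hy), hxi, hxy, ← EReal.coe_add]
    simp)
  rw [mul_assoc, hsc _ _ (inv_ne_zero hx) (inv_ne_zero hy), hxi] at h
  rw [← h, hxy, ← add_assoc, ← EReal.coe_add]
  simp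

end TensorProduct

/-- `k` a non-Archimedean local field with normalized valuation `νk`,
`D` a central division `k`-algebra of index `2` with its valuation `νD`, `E|k` a finite
extension of odd degree with its valuation `νE`; assume `Δ = E ⊗_k D` is a division
ring, and fix uniformizers `πE` of `E` and `πD` of `D`.  Then `ν⊗ν` (the sup-inf
formula) is the valuation of `Δ` extending `νk`; moreover
(i) `π_Δ = πE^{(1-e)/2} ⊗ πD` is a prime element of `Δ`, of valuation `1/(2e)`;
(ii) the valuation ring of `Δ` is the additive subgroup
     `(o_E ⊗_{o_k} o_D) + (𝔭_E^{(1-e)/2} ⊗_{o_k} 𝔭_D)`;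
(iii) the valuation ideal of `Δ` is `(𝔭_E ⊗_{o_k} o_D) + (𝔭_E^{(1-e)/2} ⊗_{o_k} 𝔭_D)`. -/
theorem stmt_11
    {k E D : Type*} [Field k] [Field E] [Algebra k E] [FiniteDimensional k E]
    [DivisionRing D] [Algebra k D]
    (νk : k → EReal) (νE : E → EReal) (νD : D → EReal) (e f q qE qD : ℕ)
    (hk : IsLocalValuation k νk 1 q) (hE : IsLocalValuation E νE e qE)
    (hD : IsLocalValuation D νD 2 qD)
    (hcompatE : ∀ c : k, νE (algebraMap k E c) = νk c)
    (hcompatD : ∀ c : k, νD (algebraMap k D c) = νk c)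
    (hdeg : Module.finrank k E = e * f) (hresdeg : qE = q ^ f)
    (hodd : Odd (Module.finrank k E))
    (hdim : Module.finrank k D = 2 * 2)
    (hcentral : ∀ z : D, (∀ w, z * w = w * z) → ∃ c : k, algebraMap k D c = z)
    (hdiv : ∀ t : TensorProduct k E D, t ≠ 0 → IsUnit t)
    (πE : E) (hπE : νE πE = (((e : ℝ)⁻¹ : ℝ) : EReal))
    (πD : D) (hπD : νD πD = (((2 : ℝ)⁻¹ : ℝ) : EReal)) :
    -- `ν⊗ν` is the valuation of `Δ` extending `νk`:
    (∀ t : TensorProduct k E D, tensorVal k νE νD t = ⊤ ↔ t = 0) ∧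
    (∀ t u : TensorProduct k E D,
      tensorVal k νE νD (t * u) = tensorVal k νE νD t + tensorVal k νE νD u) ∧
    (∀ t u : TensorProduct k E D,
      min (tensorVal k νE νD t) (tensorVal k νE νD u) ≤ tensorVal k νE νD (t + u)) ∧
    (∀ c : k, tensorVal k νE νD (algebraMap k (TensorProduct k E D) c) = νk c) ∧
    -- (i) `π_Δ` is a prime element, of valuation `1/(2e)`:
    (tensorVal k νE νD ((πE ^ ((1 - (e : ℤ)) / 2)) ⊗ₜ[k] πD)
        = ((1 / (2 * (e : ℝ)) : ℝ) : EReal)) ∧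
    (∀ t : TensorProduct k E D, 0 < tensorVal k νE νD t →
      tensorVal k νE νD ((πE ^ ((1 - (e : ℤ)) / 2)) ⊗ₜ[k] πD) ≤ tensorVal k νE νD t) ∧
    -- (ii) the valuation ring of `Δ`:
    ({t : TensorProduct k E D | 0 ≤ tensorVal k νE νD t}
      = ↑(AddSubgroup.closure
          ({t : TensorProduct k E D | ∃ x y, 0 ≤ νE x ∧ 0 ≤ νD y ∧ t = x ⊗ₜ[k] y} ∪
           {t : TensorProduct k E D | ∃ x y, 0 ≤ νE x ∧ 0 < νD y ∧
              t = (πE ^ ((1 - (e : ℤ)) / 2) * x) ⊗ₜ[k] y}))) ∧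
    -- (iii) the valuation ideal of `Δ`:
    ({t : TensorProduct k E D | 0 < tensorVal k νE νD t}
      = ↑(AddSubgroup.closure
          ({t : TensorProduct k E D | ∃ x y, 0 < νE x ∧ 0 ≤ νD y ∧ t = x ⊗ₜ[k] y} ∪
           {t : TensorProduct k E D | ∃ x y, 0 ≤ νE x ∧ 0 < νD y ∧
              t = (πE ^ ((1 - (e : ℤ)) / 2) * x) ⊗ₜ[k] y}))) := by
  have hef := hdeg ▸ hodd
  have he : Odd e := Nat.Odd.of_mul_left hef
  have hf : Odd f := Nat.Odd.of_mul_right hef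
  subst hresdeg
  obtain ⟨u, B, a, b, hBu, hB, hu, ha, hb, hquad, hroot⟩ :=
    hk.exists_splitting_basis hD hcompatD (by omega) hπD
  have hrootE (z : E) (hz : 0 ≤ νE z) :=
    hk.not_root_quadratic_of_odd hE hcompatE hf ha hb hroot hz
  have hw := isUltrametricMap_tensorVal hE hD hcompatE hB
  have hmul := tensorVal_tmul hE hD hcompatE hcompatD hB
  have hepos : (0 : ℝ) < e := by exact_mod_cast hE.e_pos
  have hzpow := hE.map_zpow hπE ((1 - (e : ℤ)) / 2)
  set j : ℤ := (1 - (e : ℤ)) / 2 with hj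
  have hπΔ : tensorVal k νE νD ((πE ^ j) ⊗ₜ[k] πD) = ((1 / (2 * (e : ℝ)) : ℝ) : EReal) := by
    rw [hmul, hzpow, hπD, ← EReal.coe_add, one_sub_div_two_add_half he]
  have hhalf {y : D} (hy : 0 < νD y) : (((2 : ℝ)⁻¹ : ℝ) : EReal) ≤ νD y := by
    by_cases hy0 : y = 0
    · simp [hy0, hD.map_zero]
    · obtain ⟨m, hm⟩ := hD.values y hy0
      rw [hm] at hy ⊢
      rw [EReal.coe_pos] at hy
      rw [EReal.coe_le_coe_iff]
      have : (0 : ℝ) < m := by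
        by_contra! h
        exact absurd hy (not_lt.2 (div_nonpos_of_nonpos_of_nonneg h (by positivity)))
      have : (1 : ℝ) ≤ m := by exact_mod_cast (by exact_mod_cast this : (0 : ℤ) < m)
      push_cast
      linarith
  have hpos {x : E} {y : D} (hx : 0 ≤ νE x) (hy : 0 < νD y) :
      0 < tensorVal k νE νD ((πE ^ j * x) ⊗ₜ[k] y) := by
    rw [hmul, hE.map_mul, hzpow]
    have h : ((j * (e : ℝ)⁻¹ : ℝ) : EReal) + (((2 : ℝ)⁻¹ : ℝ) : EReal) ≤
        ((j * (e : ℝ)⁻¹ : ℝ) : EReal) + νE x + νD y :=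
      add_le_add (le_add_of_nonneg_right hx) (hhalf hy)
    refine lt_of_lt_of_le ?_ h
    rw [← EReal.coe_add, one_sub_div_two_add_half he, EReal.coe_pos]
    positivity
  have hdecomp (t : E ⊗[k] D) : ∃ c : Fin 4 → E,
      t = c 0 ⊗ₜ[k] 1 + c 1 ⊗ₜ[k] u + (c 2 ⊗ₜ[k] πD + c 3 ⊗ₜ[k] (u * πD)) ∧
      tensorVal k νE νD t ≤ νE (c 0) ∧ tensorVal k νE νD t ≤ νE (c 1) ∧
      tensorVal k νE νD t ≤ νE (c 2) + (((2 : ℝ)⁻¹ : ℝ) : EReal) ∧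
      tensorVal k νE νD t ≤ νE (c 3) + (((2 : ℝ)⁻¹ : ℝ) : EReal) := by
    have hci := (le_tensorVal_iff hE hD hcompatE hB (t := t)).1 le_rfl
    refine ⟨fun i => (B.baseChange E).repr t i, ?_, ?_, ?_, ?_, ?_⟩
    · conv_lhs => rw [← sum_repr_baseChange B t, Fin.sum_univ_four, hBu]
      simp [add_assoc]
    · simpa [hBu, hD.map_one] using hci 0
    · simpa [hBu, hu] using hci 1
    · simpa [hBu, hπD] using hci 2
    · simpa [hBu, hD.map_mul, hu, hπD] using hci 3
  have hπE0 : πE ^ j ≠ 0 := hE.ne_zero_of_eq hzpow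
  have hfactor {x : E} (hx : 0 ≤ νE x + (((2 : ℝ)⁻¹ : ℝ) : EReal)) :
      ∃ x', 0 ≤ νE x' ∧ x = πE ^ j * x' := by
    refine ⟨(πE ^ j)⁻¹ * x, ?_, by rw [mul_inv_cancel_left₀ hπE0]⟩
    rw [hE.map_mul, hE.map_inv hzpow]
    refine le_trans ?_ (add_le_add_right (hE.one_sub_div_two_le he hx) _)
    rw [← EReal.coe_add]
    simp [hj]
  have huπ : 0 < νD (u * πD) ∧ 0 < νD πD := by
    rw [hD.map_mul, hu, zero_add, hπD, EReal.coe_pos]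
    norm_num
  refine ⟨tensorVal_eq_top_iff hE hD hcompatE hB,
    tensorVal_mul hE hD hcompatE hcompatD hB fun t ht =>
      exists_mul_sub_tmul_one_pos hE hD hcompatE hcompatD he hB hBu hu hπD ha hb hquad hrootE ht,
    hw.min_le_add, fun c => ?_, hπΔ, fun t ht => ?_, ?_, ?_⟩
  · rw [Algebra.TensorProduct.algebraMap_apply, hmul, hD.map_one, add_zero, hcompatE]
  · rw [hπΔ]
    by_cases ht0 : t = 0
    · simp [ht0, hw.map_zero]
    · obtain ⟨x, y, hx, hy, hxy⟩ := exists_tensorVal_eq hE hD hcompatE hB ht0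
      obtain ⟨m, hm⟩ := hE.values x hx
      obtain ⟨n, hn⟩ := hD.values y hy
      rw [hxy, hm, hn, ← EReal.coe_add] at ht ⊢
      rw [EReal.coe_pos] at ht
      rw [EReal.coe_le_coe_iff]
      have hmn : (m / e + n / (2 : ℕ) : ℝ) = ((2 * m + n * e : ℤ) : ℝ) / (2 * e) := by
        push_cast
        field_simp
      rw [hmn] at ht ⊢
      have h0 : (0 : ℝ) < ((2 * m + n * e : ℤ) : ℝ) := by
        by_contra! h
        exact absurd ht (not_lt.2 (div_nonpos_of_nonpos_of_nonneg h (by positivity)))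
      gcongr
      exact_mod_cast (by exact_mod_cast h0 : (0 : ℤ) < 2 * m + n * e)
  · ext t
    refine ⟨fun ht => ?_, fun ht => ?_⟩
    · obtain ⟨c, hc, h0, h1, h2, h3⟩ := hdecomp t
      have ht : 0 ≤ tensorVal k νE νD t := ht
      obtain ⟨x₂, hx₂, h2⟩ := hfactor (ht.trans h2)
      obtain ⟨x₃, hx₃, h3⟩ := hfactor (ht.trans h3)
      rw [hc, h2, h3]
      refine add_mem (add_mem ?_ ?_) (add_mem ?_ ?_) <;> apply AddSubgroup.subset_closure
      · exact Or.inl ⟨_, _, ht.trans h0, hD.map_one.ge, rfl⟩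
      · exact Or.inl ⟨_, _, ht.trans h1, hu.ge, rfl⟩
      · exact Or.inr ⟨_, _, hx₂, huπ.2, rfl⟩
      · exact Or.inr ⟨_, _, hx₃, huπ.1, rfl⟩
    · change 0 ≤ tensorVal k νE νD t
      refine AddSubgroup.closure_induction (p := fun t _ => 0 ≤ tensorVal k νE νD t) ?_ ?_
        (fun _ _ _ _ => hw.le_add) (fun _ _ h => by rwa [hw.map_neg]) ht
      · rintro _ (⟨x, y, hx, hy, rfl⟩ | ⟨x, y, hx, hy, rfl⟩)
        · rw [hmul]
          exact add_nonneg hx hy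
        · exact (hpos hx hy).le
      · simp [hw.map_zero]
  · ext t
    refine ⟨fun ht => ?_, fun ht => ?_⟩
    · obtain ⟨c, hc, h0, h1, h2, h3⟩ := hdecomp t
      have ht : 0 < tensorVal k νE νD t := ht
      obtain ⟨x₂, hx₂, h2⟩ := hfactor (ht.le.trans h2)
      obtain ⟨x₃, hx₃, h3⟩ := hfactor (ht.le.trans h3)
      rw [hc, h2, h3]
      refine add_mem (add_mem ?_ ?_) (add_mem ?_ ?_) <;> apply AddSubgroup.subset_closure
      · exact Or.inl ⟨_, _, ht.trans_le h0, hD.map_one.ge, rfl⟩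
      · exact Or.inl ⟨_, _, ht.trans_le h1, hu.ge, rfl⟩
      · exact Or.inr ⟨_, _, hx₂, huπ.2, rfl⟩
      · exact Or.inr ⟨_, _, hx₃, huπ.1, rfl⟩
    · change 0 < tensorVal k νE νD t
      refine AddSubgroup.closure_induction (p := fun t _ => 0 < tensorVal k νE νD t) ?_ ?_
        (fun _ _ _ _ => hw.lt_add) (fun _ _ h => by rwa [hw.map_neg]) ht
      · rintro _ (⟨x, y, hx, hy, rfl⟩ | ⟨x, y, hx, hy, rfl⟩)
        · rw [hmul]
          exact hx.trans_le (le_add_of_nonneg_right hy)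
        · exact hpos hx hy
      · simp [hw.map_zero]
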